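/- arXiv:1611.01335 — 3 statements merged into one kernel-verified Lean document; each statement's English description precedes it below -/
import Mathlib

section
/- Monotonicity and tensorization of the Φ-SDPI constant: let Φ be a function in the class 𝓕. (i) If X − A − B − Y forms a Markov chain (random variables on finite sets), then η_Φ(X, Y) ≤ η_Φ(A, B). (ii) If (A, B) is independent of (X, Y), then η_Φ((A,X), (B,Y)) = max{ η_Φ(A, B), η_Φ(X, Y) }. -/
open Finset

noncomputable section

/-- A probability mass function on a finite type. -/
def IsPMF {Ω : Type*} [Fintype Ω] (p : Ω → ℝ) : Prop :=
  (∀ ω, 0 ≤ p ω) ∧ ∑ ω, p ω = 1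

/-- Expectation of `f` under the pmf `p`. -/
def expect {Ω : Type*} [Fintype Ω] (p : Ω → ℝ) (f : Ω → ℝ) : ℝ :=
  ∑ ω, p ω * f ω

/-- Variance of `f` under the pmf `p`. -/
def var {Ω : Type*} [Fintype Ω] (p : Ω → ℝ) (f : Ω → ℝ) : ℝ :=
  ∑ ω, p ω * (f ω - expect p f) ^ 2

open scoped Classical in
/-- Conditional expectation `E[f | X]`, as a function on the sample space. -/
def condExp {Ω β : Type*} [Fintype Ω] (p : Ω → ℝ) (f : Ω → ℝ) (X : Ω → β) : Ω → ℝ :=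
  fun ω => (∑ ω', if X ω' = X ω then p ω' * f ω' else 0) /
    (∑ ω', if X ω' = X ω then p ω' else 0)

/-- The Φ-entropy `H_Φ(f) = E[Φ(f)] - Φ(E[f])`. -/
def Hphi {Ω : Type*} [Fintype Ω] (Φ : ℝ → ℝ) (p : Ω → ℝ) (f : Ω → ℝ) : ℝ :=
  expect p (fun ω => Φ (f ω)) - Φ (expect p f)

/-- The conditional Φ-entropy `H_Φ(f | X) = E[Φ(f)] - E[Φ(E[f|X])]`. -/
def HphiCond {Ω β : Type*} [Fintype Ω] (Φ : ℝ → ℝ) (p : Ω → ℝ) (f : Ω → ℝ) (X : Ω → β) : ℝ :=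
  expect p (fun ω => Φ (f ω)) - expect p (fun ω => Φ (condExp p f X ω))

/-- The class 𝓕 of smooth convex non-affine functions `Φ` on a convex domain `D ⊆ ℝ`
such that for every `q ∈ [0,1]` the map
`(s,t) ↦ q Φ(s) + (1-q) Φ(t) - Φ(q s + (1-q) t)` is jointly convex. -/
structure ClassF where
  D : Set ℝ
  Φ : ℝ → ℝ
  convex_dom : Convex ℝ D
  smooth : ContDiffOn ℝ (⊤ : ℕ∞) Φ D
  convexOn : ConvexOn ℝ D Φ
  not_affine : ¬ ∃ a b : ℝ, ∀ t ∈ D, Φ t = a * t + b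
  joint_convex : ∀ q ∈ Set.Icc (0:ℝ) 1,
    ConvexOn ℝ (D ×ˢ D)
      (fun st : ℝ × ℝ => q * Φ st.1 + (1 - q) * Φ st.2 - Φ (q * st.1 + (1 - q) * st.2))

/-- The Φ-SDPI constant `η_Φ(X, Y)` of a joint pmf `p` on `α × β`: the infimum of all `λ ≥ 0`
such that `λ H_Φ(f) ≥ H_Φ(E[f|Y])` for every function `f` of `X` with range in `D`. -/
def etaPhi {α β : Type} [Fintype α] [Fintype β]
    (Φ : ℝ → ℝ) (D : Set ℝ) (p : α × β → ℝ) : ℝ :=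
  sInf {l : ℝ | 0 ≤ l ∧ ∀ f : α → ℝ, (∀ x, f x ∈ D) →
    l * Hphi Φ p (fun ω => f ω.1) ≥ Hphi Φ p (condExp p (fun ω => f ω.1) Prod.snd)}
/-- First marginal of a joint weight function. -/
def margFst {α β : Type*} [Fintype β] (p : α × β → ℝ) (x : α) : ℝ := ∑ y, p (x, y)

/-- Second marginal of a joint weight function. -/
def margSnd {α β : Type*} [Fintype α] (p : α × β → ℝ) (y : β) : ℝ := ∑ x, p (x, y)

/-- Conditional expectation of a function of the first coordinate given the second one,
as a function of the second coordinate. -/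
def cexp {α β : Type*} [Fintype α] (p : α × β → ℝ) (f : α → ℝ) (y : β) : ℝ :=
  (∑ x, p (x, y) * f x) / margSnd p y

/-- The strong data processing inequality with constant `l`. -/
def Sdpi {α β : Type*} [Fintype α] [Fintype β]
    (Φ : ℝ → ℝ) (D : Set ℝ) (p : α × β → ℝ) (l : ℝ) : Prop :=
  ∀ f : α → ℝ, (∀ x, f x ∈ D) →
    Hphi Φ (margSnd p) (cexp p f) ≤ l * Hphi Φ (margFst p) f

section Marginals

variable {α β : Type*} [Fintype α] {p : α × β → ℝ}

theorem margSnd_mul_cexp (hp : ∀ ω, 0 ≤ p ω) (f : α → ℝ) (y : β) :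
    margSnd p y * cexp p f y = ∑ x, p (x, y) * f x := by
  by_cases h : margSnd p y = 0
  · have h0 := (sum_eq_zero_iff_of_nonneg fun x _ => hp (x, y)).1 h
    rw [h, zero_mul, sum_eq_zero fun x hx => by rw [h0 x hx, zero_mul]]
  · rw [cexp, mul_div_cancel₀ _ h]

variable [Fintype β]

theorem IsPMF.margFst (hp : IsPMF p) : IsPMF (margFst p) :=
  ⟨fun _ => sum_nonneg fun _ _ => hp.1 _, by
    rw [← hp.2, Fintype.sum_prod_type]; rfl⟩

theorem IsPMF.margSnd (hp : IsPMF p) : IsPMF (margSnd p) :=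
  ⟨fun _ => sum_nonneg fun _ _ => hp.1 _, by
    rw [← hp.2, Fintype.sum_prod_type_right]; rfl⟩

theorem expect_comp_fst (p : α × β → ℝ) (f : α → ℝ) :
    _root_.expect p (fun ω => f ω.1) = _root_.expect (margFst p) f := by
  simp only [_root_.expect, Fintype.sum_prod_type, margFst, sum_mul]

theorem expect_comp_snd (p : α × β → ℝ) (f : β → ℝ) :
    _root_.expect p (fun ω => f ω.2) = _root_.expect (margSnd p) f := by
  simp only [_root_.expect, Fintype.sum_prod_type_right, margSnd, sum_mul]

theorem expect_margSnd_cexp (hp : ∀ ω, 0 ≤ p ω) (f : α → ℝ) :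
    _root_.expect (margSnd p) (cexp p f) = _root_.expect (margFst p) f := by
  simp only [_root_.expect, margSnd_mul_cexp hp, margFst, sum_mul]
  exact sum_comm

theorem condExp_comp_fst_snd (p : α × β → ℝ) (f : α → ℝ) :
    condExp p (fun ω => f ω.1) Prod.snd = fun ω => cexp p f ω.2 := by
  classical
  ext ω
  simp only [condExp, cexp, margSnd, Fintype.sum_prod_type, sum_ite_eq', mem_univ, if_true]

theorem Hphi_comp_fst (Φ : ℝ → ℝ) (p : α × β → ℝ) (f : α → ℝ) :
    Hphi Φ p (fun ω => f ω.1) = Hphi Φ (margFst p) f := by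
  rw [Hphi, Hphi, expect_comp_fst p (fun x => Φ (f x)), expect_comp_fst]

theorem Hphi_comp_snd (Φ : ℝ → ℝ) (p : α × β → ℝ) (f : β → ℝ) :
    Hphi Φ p (fun ω => f ω.2) = Hphi Φ (margSnd p) f := by
  rw [Hphi, Hphi, expect_comp_snd p (fun x => Φ (f x)), expect_comp_snd]

theorem Hphi_congr {μ f g : α → ℝ} (Φ : ℝ → ℝ) (h : ∀ x, μ x ≠ 0 → f x = g x) :
    Hphi Φ μ f = Hphi Φ μ g := by
  have key (Ψ : ℝ → ℝ) :
      _root_.expect μ (fun x => Ψ (f x)) = _root_.expect μ (fun x => Ψ (g x)) := by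
    refine sum_congr rfl fun x _ => ?_
    by_cases hx : μ x = 0
    · simp only [hx, zero_mul]
    · simp only [h x hx]
  rw [Hphi, Hphi, key Φ]
  exact congrArg (fun t => _ - Φ t) (key id)

/-- Chain rule for the Φ-entropy under a product measure. -/
theorem Hphi_prod (Φ : ℝ → ℝ) (μ : α → ℝ) (ν : β → ℝ) (f : α × β → ℝ) :
    Hphi Φ (fun ω => μ ω.1 * ν ω.2) f =
      _root_.expect ν (fun y => Hphi Φ μ (fun x => f (x, y))) +
        Hphi Φ ν (fun y => _root_.expect μ (fun x => f (x, y))) := by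
  have key (g : α × β → ℝ) : _root_.expect (fun ω => μ ω.1 * ν ω.2) g =
      _root_.expect ν (fun y => _root_.expect μ (fun x => g (x, y))) := by
    simp only [_root_.expect, Fintype.sum_prod_type_right, mul_sum]
    exact sum_congr rfl fun _ _ => sum_congr rfl fun _ _ => by ring
  have hsub : _root_.expect ν (fun y => Hphi Φ μ (fun x => f (x, y))) =
      _root_.expect ν (fun y => _root_.expect μ (fun x => Φ (f (x, y)))) -
        _root_.expect ν (fun y => Φ (_root_.expect μ (fun x => f (x, y)))) := by
    simp only [Hphi, _root_.expect, mul_sub, sum_sub_distrib]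
  rw [hsub, Hphi, Hphi, key, key]
  ring

end Marginals

/-- Jensen's inequality for unnormalized weights, where only the points carrying mass need
to lie in the domain. -/
theorem ConvexOn.sum_mul_map_le {ι E : Type*} [Fintype ι] [AddCommGroup E] [Module ℝ E]
    {s : Set E} {φ : E → ℝ} (hφ : ConvexOn ℝ s φ) {w : ι → ℝ} (hw : ∀ i, 0 ≤ w i)
    {v : ι → E} (hv : ∀ i, w i ≠ 0 → v i ∈ s) :
    (∑ i, w i) * φ ((∑ i, w i)⁻¹ • ∑ i, w i • v i) ≤ ∑ i, w i * φ (v i) := by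
  classical
  rcases (sum_nonneg fun i _ => hw i : 0 ≤ ∑ i, w i).eq_or_lt with h | h
  · have h0 := (sum_eq_zero_iff_of_nonneg fun i _ => hw i).1 h.symm
    rw [← h, zero_mul, sum_eq_zero fun i hi => by rw [h0 i hi, zero_mul]]
  · have e1 : ∑ i with w i ≠ 0, w i = ∑ i, w i := sum_filter_ne_zero _
    have e2 : ∑ i with w i ≠ 0, w i • v i = ∑ i, w i • v i :=
      sum_filter_of_ne fun i _ hi h => hi (by rw [h, zero_smul])
    have e3 : ∑ i with w i ≠ 0, w i • φ (v i) = ∑ i, w i * φ (v i) :=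
      sum_filter_of_ne fun i _ hi h => hi (by rw [h, zero_smul])
    have := hφ.map_centerMass_le (t := univ.filter fun i => w i ≠ 0) (w := w) (p := v)
      (fun i _ => hw i) (by rwa [e1]) (fun i hi => hv i (mem_filter.1 hi).2)
    simp only [centerMass, Function.comp_def, e1, e2, e3] at this
    rwa [smul_eq_mul, inv_mul_eq_div, le_div_iff₀' h] at this

section Jensen

variable {α β : Type*} [Fintype α] {Φ : ℝ → ℝ} {D : Set ℝ}

theorem cexp_mem {p : α × β → ℝ} (hD : Convex ℝ D) (hp : ∀ ω, 0 ≤ p ω) {f : α → ℝ}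
    (hf : ∀ x, f x ∈ D) {y : β} (hy : margSnd p y ≠ 0) : cexp p f y ∈ D := by
  have := hD.centerMass_mem (t := univ) (w := fun x => p (x, y)) (z := f)
    (fun x _ => hp _) ((sum_nonneg fun x _ => hp _).lt_of_ne' hy) (fun x _ => hf x)
  rwa [centerMass, smul_eq_mul, inv_mul_eq_div] at this

variable [Fintype β]

/-- Data processing inequality for the Φ-entropy. -/
theorem Hphi_cexp_le {p : α × β → ℝ} (hΦ : ConvexOn ℝ D Φ) (hp : ∀ ω, 0 ≤ p ω) {f : α → ℝ}
    (hf : ∀ x, margFst p x ≠ 0 → f x ∈ D) :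
    Hphi Φ (margSnd p) (cexp p f) ≤ Hphi Φ (margFst p) f := by
  rw [Hphi, Hphi, expect_margSnd_cexp hp]
  refine sub_le_sub_right ?_ _
  calc _root_.expect (margSnd p) (fun y => Φ (cexp p f y))
      ≤ ∑ y, ∑ x, p (x, y) * Φ (f x) := by
        refine sum_le_sum fun y _ => ?_
        have := hΦ.sum_mul_map_le (w := fun x => p (x, y)) (fun x => hp _) (v := f)
          (fun x hx => hf x fun h => hx
            ((sum_eq_zero_iff_of_nonneg fun y _ => hp (x, y)).1 h y (mem_univ y)))
        simpa only [smul_eq_mul, inv_mul_eq_div, margSnd, cexp] using this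
    _ = _root_.expect (margFst p) (fun x => Φ (f x)) := by
        rw [sum_comm]
        simp only [_root_.expect, margFst, sum_mul]

theorem Hphi_nonneg (hΦ : ConvexOn ℝ D Φ) {μ : α → ℝ} (hμ : IsPMF μ) {f : α → ℝ}
    (hf : ∀ x, f x ∈ D) : 0 ≤ Hphi Φ μ f := by
  have := hΦ.map_sum_le (t := univ) (fun x _ => hμ.1 x) hμ.2 (fun x _ => hf x)
  simpa only [Hphi, _root_.expect, sub_nonneg, smul_eq_mul] using this

theorem Sdpi.mono (hΦ : ConvexOn ℝ D Φ) {p : α × β → ℝ} (hp : IsPMF p) {l l' : ℝ}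
    (h : Sdpi Φ D p l) (hl : l ≤ l') : Sdpi Φ D p l' := fun f hf =>
  (h f hf).trans (mul_le_mul_of_nonneg_right hl (Hphi_nonneg hΦ hp.margFst hf))

end Jensen

section Eta

variable {α β : Type} [Fintype α] [Fintype β] {Φ : ℝ → ℝ} {D : Set ℝ} {p : α × β → ℝ}

theorem etaPhi_eq_sInf_Sdpi (Φ : ℝ → ℝ) (D : Set ℝ) (p : α × β → ℝ) :
    etaPhi Φ D p = sInf {l : ℝ | 0 ≤ l ∧ Sdpi Φ D p l} := by
  simp only [etaPhi, condExp_comp_fst_snd, Hphi_comp_fst, Hphi_comp_snd, ge_iff_le, Sdpi]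

theorem etaPhi_nonneg (Φ : ℝ → ℝ) (D : Set ℝ) (p : α × β → ℝ) : 0 ≤ etaPhi Φ D p :=
  Real.sInf_nonneg fun _ h => h.1

theorem etaPhi_le {l : ℝ} (hl : 0 ≤ l) (h : Sdpi Φ D p l) : etaPhi Φ D p ≤ l := by
  rw [etaPhi_eq_sInf_Sdpi]
  exact csInf_le ⟨0, fun _ h => h.1⟩ ⟨hl, h⟩

/-- The infimum defining the Φ-SDPI constant is attained. -/
theorem Sdpi_etaPhi (hΦ : ConvexOn ℝ D Φ) (hp : IsPMF p) : Sdpi Φ D p (etaPhi Φ D p) := by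
  have hne : {l : ℝ | 0 ≤ l ∧ Sdpi Φ D p l}.Nonempty :=
    ⟨1, zero_le_one, fun f hf => by
      rw [one_mul]; exact Hphi_cexp_le hΦ hp.1 fun x _ => hf x⟩
  have hcl : IsClosed {l : ℝ | 0 ≤ l ∧ Sdpi Φ D p l} := by
    simp only [Sdpi, Set.ofPred_and, Set.ofPred_forall]
    refine isClosed_Ici.inter (isClosed_iInter fun f => isClosed_iInter fun _ => ?_)
    exact isClosed_le continuous_const (continuous_id.mul continuous_const)
  rw [etaPhi_eq_sInf_Sdpi]
  exact (hcl.csInf_mem hne ⟨0, fun _ h => h.1⟩).2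

end Eta

/-- Joint law of the end points of the Markov chain with middle joint law `p` and kernels
`W` (from the left end) and `V` (to the right end). -/
def markovEnds {α β χ γ : Type*} [Fintype α] [Fintype β]
    (p : α × β → ℝ) (W : α → χ → ℝ) (V : β → γ → ℝ) : χ × γ → ℝ :=
  fun xz => ∑ s, ∑ t, W s xz.1 * p (s, t) * V t xz.2

theorem Sdpi.markovEnds {α β χ γ : Type*} [Fintype α] [Fintype β] [Fintype χ] [Fintype γ]
    {Φ : ℝ → ℝ} {D : Set ℝ} (hΦ : ConvexOn ℝ D Φ) {p : α × β → ℝ} (hp : IsPMF p)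
    {W : α → χ → ℝ} {V : β → γ → ℝ}
    (hW0 : ∀ s x, 0 ≤ W s x) (hW1 : ∀ s, ∑ x, W s x = 1)
    (hV0 : ∀ t z, 0 ≤ V t z) (hV1 : ∀ t, ∑ z, V t z = 1)
    {l : ℝ} (hl : 0 ≤ l) (h : Sdpi Φ D p l) : Sdpi Φ D (markovEnds p W V) l := by
  intro f hf
  set g : α → ℝ := fun s => ∑ x, W s x * f x with hg
  have hgD (s) : g s ∈ D := by
    simpa only [smul_eq_mul] using
      hΦ.1.sum_mem (t := univ) (fun x _ => hW0 s x) (hW1 s) (fun x _ => hf x)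
  let q : χ × α → ℝ := fun xs => W xs.2 xs.1 * margFst p xs.2
  let r : β × γ → ℝ := fun tz => V tz.1 tz.2 * margSnd p tz.1
  have hq : ∀ ω, 0 ≤ q ω := fun ω => mul_nonneg (hW0 _ _) (hp.margFst.1 _)
  have hr : ∀ ω, 0 ≤ r ω := fun ω => mul_nonneg (hV0 _ _) (hp.margSnd.1 _)
  have hq_snd : margSnd q = margFst p := by
    ext s; simp only [margSnd, q, ← sum_mul, hW1, one_mul]
  have hr_fst : margFst r = margSnd p := by
    ext t; simp only [margFst, r, ← sum_mul, hV1, one_mul]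
  have hq_fst : margFst q = margFst (_root_.markovEnds p W V) := by
    ext x
    simp only [margFst, q, _root_.markovEnds]
    rw [sum_comm]
    refine sum_congr rfl fun s _ => ?_
    rw [sum_comm, mul_sum]
    exact sum_congr rfl fun t _ => by rw [← mul_sum, hV1, mul_one]
  have hr_num (k : χ → ℝ) (z : γ) :
      ∑ x, _root_.markovEnds p W V (x, z) * k x =
        ∑ t, V t z * ∑ s, p (s, t) * ∑ x, W s x * k x := by
    simp only [_root_.markovEnds, sum_mul, mul_sum]
    rw [sum_comm]
    simp_rw [sum_comm (s := (univ : Finset χ))]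
    rw [sum_comm]
    exact sum_congr rfl fun _ _ => sum_congr rfl fun _ _ => sum_congr rfl fun _ _ => by ring
  have hr_snd : margSnd r = margSnd (_root_.markovEnds p W V) := by
    ext z
    have := hr_num (fun _ => 1) z
    simp only [mul_one, hW1] at this
    exact this.symm
  have hr_cexp : cexp r (cexp p g) = cexp (_root_.markovEnds p W V) f := by
    ext z
    rw [cexp, cexp, hr_snd, hr_num]
    congr 1
    refine sum_congr rfl fun t _ => ?_
    rw [← margSnd_mul_cexp hp.1, ← mul_assoc]
  have h1 : Hphi Φ (margFst p) g ≤ Hphi Φ (margFst (_root_.markovEnds p W V)) f := by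
    rw [← hq_fst, ← hq_snd]
    refine le_of_eq_of_le (Hphi_congr Φ fun s hs => ?_)
      (Hphi_cexp_le hΦ hq fun x _ => hf x)
    rw [cexp, eq_div_iff hs, hq_snd, hg, sum_mul]
    exact sum_congr rfl fun x _ => by ring
  have h2 : Hphi Φ (margSnd (_root_.markovEnds p W V)) (cexp (_root_.markovEnds p W V) f) ≤
      Hphi Φ (margSnd p) (cexp p g) := by
    rw [← hr_cexp, ← hr_snd, ← hr_fst]
    exact Hphi_cexp_le hΦ hr fun t ht => cexp_mem hΦ.1 hp.1 hgD (by rwa [← hr_fst])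
  exact h2.trans ((h g hgD).trans (mul_le_mul_of_nonneg_left h1 hl))

/-- The unnormalized Φ-entropy is a convex functional. -/
theorem ClassF.convexOn_entropy (F : ClassF) {ι : Type*} {w : ι → ℝ} (hw : ∀ i, 0 ≤ w i)
    (s : Finset ι) :
    ConvexOn ℝ {f : ι → ℝ | ∀ i, f i ∈ F.D} (fun f =>
      ∑ i ∈ s, w i * F.Φ (f i) -
        (∑ i ∈ s, w i) * F.Φ ((∑ i ∈ s, w i)⁻¹ * ∑ i ∈ s, w i * f i)) := by
  classical
  have hdom : Convex ℝ {f : ι → ℝ | ∀ i, f i ∈ F.D} :=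
    fun f hf g hg a b ha hb hab i => F.convex_dom (hf i) (hg i) ha hb hab
  induction s using Finset.induction_on with
  | empty => simpa using convexOn_const 0 hdom
  | insert j s hj ih =>
    simp only [sum_insert hj]
    set S := ∑ i ∈ s, w i
    have hS : 0 ≤ S := sum_nonneg fun i _ => hw i
    rcases hS.eq_or_lt with h | h
    · have h0 := (sum_eq_zero_iff_of_nonneg fun i _ => hw i).1 h.symm
      refine (convexOn_const 0 hdom).congr fun f _ => ?_
      rw [← h, sum_eq_zero fun i hi => by rw [h0 i hi, zero_mul],
        sum_eq_zero fun i hi => by rw [h0 i hi, zero_mul]]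
      simp only [add_zero]
      rcases eq_or_ne (w j) 0 with hj0 | hj0
      · simp [hj0]
      · rw [inv_mul_cancel_left₀ hj0, sub_self]
    · have hT : 0 < w j + S := add_pos_of_nonneg_of_pos (hw j) h
      let L : (ι → ℝ) →ₗ[ℝ] ℝ × ℝ :=
        (LinearMap.proj j).prod (S⁻¹ • ∑ i ∈ s, w i • LinearMap.proj i)
      have hL (f : ι → ℝ) : L f = (f j, S⁻¹ * ∑ i ∈ s, w i * f i) := by
        simp [L]
      have hq : w j / (w j + S) ∈ Set.Icc (0 : ℝ) 1 :=
        ⟨div_nonneg (hw j) hT.le, (div_le_one hT).2 (by linarith)⟩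
      have h2 := ((F.joint_convex _ hq).comp_linearMap L).subset
        (s := {f : ι → ℝ | ∀ i, f i ∈ F.D}) (fun f hf => by
          rw [Set.mem_preimage, hL]
          refine ⟨hf j, ?_⟩
          have := F.convex_dom.centerMass_mem (t := s) (w := w) (z := f)
            (fun i _ => hw i) h (fun i _ => hf i)
          simpa only [centerMass, smul_eq_mul] using this) hdom
      refine (ih.add (h2.smul hT.le)).congr fun f _ => ?_
      have e : 1 - w j / (w j + S) = S / (w j + S) := by field_simp; ring
      simp only [Pi.add_apply, Function.comp_apply, hL, smul_eq_mul, e]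
      have e' : w j / (w j + S) * f j + S / (w j + S) * (S⁻¹ * ∑ i ∈ s, w i * f i) =
          (w j + S)⁻¹ * (w j * f j + ∑ i ∈ s, w i * f i) := by
        rw [div_mul_eq_mul_div, div_mul_eq_mul_div, mul_inv_cancel_left₀ h.ne', ← add_div,
          inv_mul_eq_div]
      rw [e']
      field_simp
      ring

theorem ClassF.convexOn_Hphi (F : ClassF) {α : Type*} [Fintype α] {μ : α → ℝ} (hμ : IsPMF μ) :
    ConvexOn ℝ {f : α → ℝ | ∀ i, f i ∈ F.D} (Hphi F.Φ μ) := by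
  refine (F.convexOn_entropy hμ.1 univ).congr fun f _ => ?_
  simp only [hμ.2, inv_one, one_mul, Hphi, _root_.expect]

/-- Joint law of two independent pairs, regrouped by first and second coordinates. -/
def prodJoint {α β χ γ : Type*} (p : α × β → ℝ) (q : χ × γ → ℝ) : (α × χ) × (β × γ) → ℝ :=
  fun ω => p (ω.1.1, ω.2.1) * q (ω.1.2, ω.2.2)

section Product

variable {α β χ γ : Type*} [Fintype α] [Fintype β] [Fintype χ] [Fintype γ]
  {p : α × β → ℝ} {q : χ × γ → ℝ}

theorem margFst_prodJoint {α β χ γ : Type*} [Fintype β] [Fintype γ] (p : α × β → ℝ) (q : χ × γ → ℝ) :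
    margFst (prodJoint p q) = fun ω => margFst p ω.1 * margFst q ω.2 := by
  ext ω
  simp only [margFst, prodJoint, Fintype.sum_prod_type, sum_mul_sum]

theorem margSnd_prodJoint {α β χ γ : Type*} [Fintype α] [Fintype χ] (p : α × β → ℝ) (q : χ × γ → ℝ) :
    margSnd (prodJoint p q) = fun ω => margSnd p ω.1 * margSnd q ω.2 := by
  ext ω
  simp only [margSnd, prodJoint, Fintype.sum_prod_type, sum_mul_sum]

theorem IsPMF.prodJoint (hp : IsPMF p) (hq : IsPMF q) : IsPMF (prodJoint p q) := by
  refine ⟨fun ω => mul_nonneg (hp.1 _) (hq.1 _), ?_⟩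
  have h : ∑ ω, _root_.prodJoint p q ω = ∑ ω, _root_.margFst (_root_.prodJoint p q) ω :=
    Fintype.sum_prod_type _
  rw [h, margFst_prodJoint, Fintype.sum_prod_type, ← sum_mul_sum, hp.margFst.2,
    hq.margFst.2, one_mul]

theorem cexp_prodJoint {α β χ γ : Type*} [Fintype α] [Fintype χ]
    (p : α × β → ℝ) (q : χ × γ → ℝ) (f : α × χ → ℝ) (b : β) (y : γ) :
    cexp (prodJoint p q) f (b, y) = cexp p (fun a => cexp q (fun x => f (a, x)) y) b := by
  simp only [cexp, margSnd_prodJoint]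
  rw [mul_comm (margSnd p b), ← div_div]
  congr 1
  simp only [mul_div_assoc', ← sum_div]
  congr 1
  simp only [prodJoint, Fintype.sum_prod_type, mul_sum, mul_assoc]

theorem expect_cexp_comm {α χ γ : Type*} [Fintype α] [Fintype χ] (μ : α → ℝ) (q : χ × γ → ℝ) (f : α × χ → ℝ) (y : γ) :
    _root_.expect μ (fun a => cexp q (fun x => f (a, x)) y) =
      cexp q (fun x => _root_.expect μ (fun a => f (a, x))) y := by
  simp only [_root_.expect, cexp, mul_div_assoc', ← sum_div, mul_sum]
  rw [sum_comm]
  congr 1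
  exact sum_congr rfl fun _ _ => sum_congr rfl fun _ _ => by ring

theorem ClassF.expect_Hphi_cexp_le (F : ClassF) {μ : α → ℝ} (hμ : IsPMF μ)
    (hq : ∀ ω, 0 ≤ q ω) {f : α × χ → ℝ} (hf : ∀ ω, f ω ∈ F.D) :
    _root_.expect (margSnd q) (fun y => Hphi F.Φ μ (fun a => cexp q (fun x => f (a, x)) y)) ≤
      _root_.expect (margFst q) (fun x => Hphi F.Φ μ (fun a => f (a, x))) := by
  calc _ ≤ ∑ y, ∑ x, q (x, y) * Hphi F.Φ μ (fun a => f (a, x)) := by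
        refine sum_le_sum fun y _ => ?_
        refine le_of_eq_of_le ?_ ((F.convexOn_Hphi hμ).sum_mul_map_le (w := fun x => q (x, y))
          (fun x => hq _) (v := fun x a => f (a, x)) (fun x _ a => hf _))
        change margSnd q y * _ = margSnd q y * _
        refine congrArg (fun g => margSnd q y * Hphi F.Φ μ g) (funext fun a => ?_)
        simp only [Pi.smul_apply, Finset.sum_apply, smul_eq_mul, inv_mul_eq_div, cexp, margSnd]
    _ = _ := by
        rw [sum_comm]
        simp only [_root_.expect, margFst, sum_mul]

theorem Sdpi.prodJoint {F : ClassF} (hp : IsPMF p) (hq : IsPMF q) {l : ℝ} (hl : 0 ≤ l)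
    (h₁ : Sdpi F.Φ F.D p l) (h₂ : Sdpi F.Φ F.D q l) :
    Sdpi F.Φ F.D (prodJoint p q) l := by
  intro f hf
  rw [margFst_prodJoint, margSnd_prodJoint, Hphi_prod, Hphi_prod, mul_add]
  simp only [cexp_prodJoint, expect_margSnd_cexp hp.1, expect_cexp_comm]
  refine add_le_add ?_ (h₂ _ fun x => ?_)
  · refine le_trans ?_ (mul_le_mul_of_nonneg_left
      (F.expect_Hphi_cexp_le hp.margFst hq.1 hf) hl)
    simp only [_root_.expect, mul_sum]
    refine sum_le_sum fun y _ => ?_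
    rw [mul_left_comm]
    by_cases hy : margSnd q y = 0
    · simp only [hy, zero_mul, le_refl]
    · exact mul_le_mul_of_nonneg_left
        (h₁ _ fun a => cexp_mem F.convex_dom hq.1 (fun x => hf _) hy) (hq.margSnd.1 y)
  · simpa only [smul_eq_mul, _root_.expect] using F.convex_dom.sum_mem (t := univ)
      (fun a _ => hp.margFst.1 a) hp.margFst.2 (fun a _ => hf (a, x))

open scoped Classical in
theorem markovEnds_prodJoint_fst (p : α × β → ℝ) (hq : IsPMF q) :
    markovEnds (prodJoint p q) (fun s x => if s.1 = x then 1 else 0)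
      (fun t z => if t.1 = z then 1 else 0) = p := by
  ext ⟨x, z⟩
  have h : ∑ u, ∑ v, q (u, v) = 1 := by rw [← hq.2, Fintype.sum_prod_type]
  simp only [markovEnds, prodJoint, Fintype.sum_prod_type_right, ite_mul, mul_ite, one_mul,
    mul_one, zero_mul, mul_zero, sum_ite_eq', mem_univ, if_true]
  simp [← mul_sum, h]

open scoped Classical in
theorem markovEnds_prodJoint_snd (hp : IsPMF p) (q : χ × γ → ℝ) :
    markovEnds (prodJoint p q) (fun s x => if s.2 = x then 1 else 0)
      (fun t z => if t.2 = z then 1 else 0) = q := by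
  ext ⟨x, z⟩
  have h : ∑ u, ∑ v, p (u, v) = 1 := by rw [← hp.2, Fintype.sum_prod_type]
  simp only [markovEnds, prodJoint, Fintype.sum_prod_type, ite_mul, mul_ite, one_mul,
    mul_one, zero_mul, mul_zero, sum_ite_eq', mem_univ, if_true]
  simp [← sum_mul, h]

end Product

theorem etaPhi_markovEnds_le {Φ : ℝ → ℝ} {D : Set ℝ} (hΦ : ConvexOn ℝ D Φ)
    {α β χ γ : Type} [Fintype α] [Fintype β] [Fintype χ] [Fintype γ]
    {p : α × β → ℝ} (hp : IsPMF p) {W : α → χ → ℝ} {V : β → γ → ℝ}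
    (hW0 : ∀ s x, 0 ≤ W s x) (hW1 : ∀ s, ∑ x, W s x = 1)
    (hV0 : ∀ t z, 0 ≤ V t z) (hV1 : ∀ t, ∑ z, V t z = 1) :
    etaPhi Φ D (markovEnds p W V) ≤ etaPhi Φ D p :=
  etaPhi_le (etaPhi_nonneg ..)
    ((Sdpi_etaPhi hΦ hp).markovEnds hΦ hp hW0 hW1 hV0 hV1 (etaPhi_nonneg ..))

/-- Monotonicity and tensorization of the Φ-SDPI constant for `Φ ∈ 𝓕`:
(i) if `X − A − B − Y` is a Markov chain (joint law factorizing as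
`p(x,a,b,y) = W(x|a) p(a,b) V(y|b)`), then `η_Φ(X, Y) ≤ η_Φ(A, B)`;
(ii) if `(A,B)` is independent of `(X,Y)`, then
`η_Φ((A,X), (B,Y)) = max(η_Φ(A,B), η_Φ(X,Y))`. -/
theorem etaPhi_monotonicity_and_tensorization (F : ClassF) :
    (∀ (χ a b y : Type) [Fintype χ] [Fintype a] [Fintype b] [Fintype y],
      ∀ (pab : a × b → ℝ) (W : a → χ → ℝ) (V : b → y → ℝ),
        IsPMF pab →
        (∀ s x, 0 ≤ W s x) → (∀ s, ∑ x, W s x = 1) →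
        (∀ t z, 0 ≤ V t z) → (∀ t, ∑ z, V t z = 1) →
        etaPhi F.Φ F.D
            (fun xz : χ × y => ∑ s, ∑ t, W s xz.1 * pab (s, t) * V t xz.2)
          ≤ etaPhi F.Φ F.D pab) ∧
    (∀ (a b χ y : Type) [Fintype a] [Fintype b] [Fintype χ] [Fintype y],
      ∀ (pab : a × b → ℝ) (pxy : χ × y → ℝ),
        IsPMF pab → IsPMF pxy →
        etaPhi F.Φ F.D
            (fun ω : (a × χ) × (b × y) => pab (ω.1.1, ω.2.1) * pxy (ω.1.2, ω.2.2))
          = max (etaPhi F.Φ F.D pab) (etaPhi F.Φ F.D pxy)) := by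
  classical
  refine ⟨fun χ a b y _ _ _ _ pab W V hp hW0 hW1 hV0 hV1 =>
    etaPhi_markovEnds_le F.convexOn hp hW0 hW1 hV0 hV1, ?_⟩
  intro a b χ y _ _ _ _ pab pxy hp hq
  change etaPhi F.Φ F.D (prodJoint pab pxy) = _
  have hind {σ τ : Type} [DecidableEq τ] (π : σ → τ) (s : σ) (t : τ) :
      (0 : ℝ) ≤ if π s = t then 1 else 0 := by split_ifs <;> norm_num
  refine le_antisymm ?_ (max_le ?_ ?_)
  · have hmax : 0 ≤ max (etaPhi F.Φ F.D pab) (etaPhi F.Φ F.D pxy) :=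
      le_max_of_le_left (etaPhi_nonneg ..)
    exact etaPhi_le hmax (Sdpi.prodJoint hp hq hmax
      ((Sdpi_etaPhi F.convexOn hp).mono F.convexOn hp (le_max_left _ _))
      ((Sdpi_etaPhi F.convexOn hq).mono F.convexOn hq (le_max_right _ _)))
  · have := etaPhi_markovEnds_le F.convexOn (hp.prodJoint hq)
      (W := fun s x => if s.1 = x then 1 else 0) (V := fun t z => if t.1 = z then 1 else 0)
      (hind Prod.fst) (by simp) (hind Prod.fst) (by simp)
    rwa [markovEnds_prodJoint_fst pab hq] at this
  · have := etaPhi_markovEnds_le F.convexOn (hp.prodJoint hq)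
      (W := fun s x => if s.2 = x then 1 else 0) (V := fun t z => if t.2 = z then 1 else 0)
      (hind Prod.snd) (by simp) (hind Prod.snd) (by simp)
    rwa [markovEnds_prodJoint_snd hp pxy] at this

end
end

section
/- In the definition of the maximal correlation ribbon 𝔖(X_1, …, X_k) one may restrict to additive functions: a tuple (λ_1, …, λ_k) ∈ [0,1]^k belongs to 𝔖(X_1, …, X_k) if and only if for all real-valued functions f_1(X_1), …, f_k(X_k), with f = f_1 + ⋯ + f_k, one has Var[f] ≥ Σ_{i=1}^k λ_i Var[E[f | X_i]]. -/
open Finset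

noncomputable section

/-- The maximal correlation ribbon `𝔖(X_1, …, X_k)` of a joint pmf `p`: all tuples
`λ ∈ [0,1]^k` such that `Var[f] ≥ Σ_i λ_i Var[E[f | X_i]]` for every real-valued `f`. -/
def mcRibbon {k : ℕ} {α : Fin k → Type} [∀ i, Fintype (α i)]
    (p : (∀ i, α i) → ℝ) : Set (Fin k → ℝ) :=
  {l | (∀ i, l i ∈ Set.Icc (0:ℝ) 1) ∧ ∀ f : (∀ i, α i) → ℝ,
    var p f ≥ ∑ i, l i * var p (condExp p f (fun ω => ω i))}
section AdditiveFunctions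

variable {Ω β ι : Type*} [Fintype Ω] {p : Ω → ℝ}

/-- Covariance of `f` and `g` under the pmf `p`. -/
def covar (p f g : Ω → ℝ) : ℝ :=
  ∑ ω, p ω * (f ω * g ω) - (∑ ω, p ω * f ω) * ∑ ω, p ω * g ω

lemma covar_comm (p f g : Ω → ℝ) : covar p f g = covar p g f := by
  simp only [covar, mul_comm (f _) (g _), mul_comm (∑ ω, p ω * f ω)]

lemma covar_sum_right (p f : Ω → ℝ) (s : Finset ι) (l : ι → ℝ) (g : ι → Ω → ℝ) :
    covar p f (fun ω => ∑ i ∈ s, l i * g i ω) = ∑ i ∈ s, l i * covar p f (g i) := by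
  simp only [covar, mul_sub, Finset.mul_sum, Finset.sum_sub_distrib]
  congr 1
  · rw [Finset.sum_comm]
    refine Finset.sum_congr rfl fun i _ => Finset.sum_congr rfl fun ω _ => ?_
    ring
  · rw [Finset.sum_comm]
    refine Finset.sum_congr rfl fun i _ => Finset.sum_congr rfl fun ω _ => ?_
    ring

lemma var_eq_covar_self (hp : IsPMF p) (f : Ω → ℝ) : var p f = covar p f f := by
  have key (m : ℝ) : ∑ ω, p ω * (f ω - m) ^ 2
      = ∑ ω, p ω * (f ω * f ω) - 2 * m * ∑ ω, p ω * f ω + m ^ 2 * ∑ ω, p ω := by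
    simp only [Finset.mul_sum, ← Finset.sum_sub_distrib, ← Finset.sum_add_distrib]
    refine Finset.sum_congr rfl fun ω _ => ?_
    ring
  rw [var, key, hp.2, covar, _root_.expect]
  ring

lemma var_nonneg (hp : IsPMF p) (f : Ω → ℝ) : 0 ≤ var p f :=
  Finset.sum_nonneg fun ω _ => mul_nonneg (hp.1 ω) (sq_nonneg _)

lemma var_sub (hp : IsPMF p) (f g : Ω → ℝ) :
    var p (fun ω => f ω - g ω) = var p f - 2 * covar p f g + var p g := by
  have h : ∑ ω, p ω * ((f ω - g ω) * (f ω - g ω)) = ∑ ω, p ω * (f ω * f ω)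
      - 2 * ∑ ω, p ω * (f ω * g ω) + ∑ ω, p ω * (g ω * g ω) := by
    simp only [Finset.mul_sum, ← Finset.sum_sub_distrib, ← Finset.sum_add_distrib]
    refine Finset.sum_congr rfl fun ω _ => ?_
    ring
  simp only [var_eq_covar_self hp, covar, h, mul_sub (p _) (f _), Finset.sum_sub_distrib]
  ring

lemma condExp_sub (p f g : Ω → ℝ) (X : Ω → β) :
    condExp p (fun ω => f ω - g ω) X = fun ω => condExp p f X ω - condExp p g X ω := by
  funext ω
  simp only [condExp, ← sub_div, ← Finset.sum_sub_distrib]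
  congr 1
  refine Finset.sum_congr rfl fun ω' _ => ?_
  split_ifs <;> ring

lemma condExp_congr (p f : Ω → ℝ) {X : Ω → β} {ω ω' : Ω} (h : X ω = X ω') :
    condExp p f X ω = condExp p f X ω' := by
  unfold condExp
  rw [h]

lemma sum_condExp_mul (hp : IsPMF p) (f : Ω → ℝ) (X : Ω → β) (φ : Ω → ℝ)
    (hφ : ∀ ω ω', X ω = X ω' → φ ω = φ ω') :
    ∑ ω, p ω * (condExp p f X ω * φ ω) = ∑ ω, p ω * (f ω * φ ω) := by
  classical
  set c : Ω → ℝ := fun ω => ∑ ω', if X ω' = X ω then p ω' else 0 with hc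
  have hc_congr (ω ω' : Ω) (h : X ω = X ω') : c ω = c ω' := by simp only [hc, h]
  have hp_eq_zero (ω : Ω) (h : c ω = 0) : p ω = 0 := by
    have := (Finset.sum_eq_zero_iff_of_nonneg (fun ω' _ => by
      split_ifs
      · exact hp.1 ω'
      · exact le_rfl)).1 h ω (Finset.mem_univ ω)
    simpa using this
  calc ∑ ω, p ω * (condExp p f X ω * φ ω)
      = ∑ ω, ∑ ω', if X ω' = X ω then p ω * (p ω' * f ω') * φ ω / c ω else 0 := by
        refine Finset.sum_congr rfl fun ω _ => ?_
        have : condExp p f X ω = (∑ ω', if X ω' = X ω then p ω' * f ω' else 0) / c ω := by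
          simp only [condExp, hc]
        rw [this, div_mul_eq_mul_div, mul_div_assoc', Finset.sum_mul, Finset.mul_sum,
          Finset.sum_div]
        refine Finset.sum_congr rfl fun ω' _ => ?_
        split_ifs <;> ring
    _ = ∑ ω', ∑ ω, if X ω = X ω' then p ω * (p ω' * f ω' * φ ω' / c ω') else 0 := by
        rw [Finset.sum_comm]
        refine Finset.sum_congr rfl fun ω' _ => Finset.sum_congr rfl fun ω _ => ?_
        by_cases h : X ω = X ω'
        · rw [if_pos h, if_pos h.symm, hφ ω ω' h, hc_congr ω ω' h]
          ring
        · rw [if_neg h, if_neg (Ne.symm h)]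
    _ = ∑ ω, p ω * (f ω * φ ω) := by
        refine Finset.sum_congr rfl fun ω' _ => ?_
        have : (∑ ω, if X ω = X ω' then p ω * (p ω' * f ω' * φ ω' / c ω') else 0)
            = c ω' * (p ω' * f ω' * φ ω' / c ω') := by
          simp only [hc, Finset.sum_mul, ite_mul, zero_mul]
        rw [this]
        by_cases h : c ω' = 0
        · simp [h, hp_eq_zero ω' h]
        · field_simp

lemma covar_condExp_condExp (hp : IsPMF p) (f g : Ω → ℝ) (X : Ω → β) :
    covar p (condExp p f X) (condExp p g X) = covar p f (condExp p g X) := by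
  have hmean := sum_condExp_mul hp f X (fun _ => 1) fun _ _ _ => rfl
  simp only [mul_one] at hmean
  rw [covar, covar, hmean,
    sum_condExp_mul hp f X (condExp p g X) fun _ _ h => condExp_congr p g h]

/-- If the ribbon inequality holds for `g = ∑ i, l i * E[f | X i]`, it holds for `f`. -/
lemma sum_var_condExp_le_var [Fintype ι] {β : ι → Type*} (hp : IsPMF p) (X : ∀ i, Ω → β i)
    {l : ι → ℝ} (hl : ∀ i, 0 ≤ l i) (f g : Ω → ℝ)
    (hg : g = fun ω => ∑ i, l i * condExp p f (X i) ω)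
    (h : ∑ i, l i * var p (condExp p g (X i)) ≤ var p g) :
    ∑ i, l i * var p (condExp p f (X i)) ≤ var p f := by
  have hfg : covar p f g = ∑ i, l i * var p (condExp p f (X i)) := by
    rw [hg, covar_sum_right]
    refine Finset.sum_congr rfl fun i _ => ?_
    rw [var_eq_covar_self hp, covar_condExp_condExp hp]
  have hgg : var p g = ∑ i, l i * covar p (condExp p f (X i)) (condExp p g (X i)) := by
    rw [var_eq_covar_self hp]
    nth_rewrite 2 [hg]
    rw [covar_sum_right]
    refine Finset.sum_congr rfl fun i _ => ?_
    rw [covar_comm p (condExp p f (X i)), covar_condExp_condExp hp]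
  have hsum : 0 ≤ ∑ i, l i * var p (condExp p (fun ω => f ω - g ω) (X i)) :=
    Finset.sum_nonneg fun i _ => mul_nonneg (hl i) (var_nonneg hp _)
  simp only [condExp_sub, var_sub hp, mul_add, mul_sub, mul_left_comm _ (2 : ℝ),
    Finset.sum_add_distrib, Finset.sum_sub_distrib, ← Finset.mul_sum] at hsum
  have hdiff := var_nonneg hp fun ω => f ω - g ω
  rw [var_sub hp] at hdiff
  linarith

end AdditiveFunctions

/-- In the definition of the MC ribbon one may restrict to additive
functions: a tuple `λ ∈ [0,1]^k` belongs to `𝔖(X_1, …, X_k)` iff for all functions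
`f_1(X_1), …, f_k(X_k)`, with `f = f_1 + ⋯ + f_k`,
`Var[f] ≥ Σ_i λ_i Var[E[f | X_i]]`. -/
theorem mcRibbon_additive_functions
    {k : ℕ} {α : Fin k → Type} [∀ i, Fintype (α i)]
    (p : (∀ i, α i) → ℝ) (hp : IsPMF p)
    (l : Fin k → ℝ) (hl : ∀ i, l i ∈ Set.Icc (0:ℝ) 1) :
    l ∈ mcRibbon p ↔
      ∀ f : (i : Fin k) → α i → ℝ,
        var p (fun ω => ∑ j, f j (ω j))
          ≥ ∑ i, l i * var p (condExp p (fun ω => ∑ j, f j (ω j)) (fun ω => ω i)) := by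
  classical
  refine ⟨fun h f => h.2 _, fun h => ⟨hl, fun f => ?_⟩⟩
  exact sum_var_condExp_le_var hp (fun i ω => ω i) (fun i => (hl i).1) f _ rfl
    (h fun i a => l i * ((∑ ω', if ω' i = a then p ω' * f ω' else 0) /
      ∑ ω', if ω' i = a then p ω' else 0))

end
end

section
/- Let (X, Y) be distributed according to the doubly symmetric binary source DSBS(λ) with parameter λ ∈ [0,1]: X and Y are {0,1}-valued, each uniform, with P(X=0,Y=1) = P(X=1,Y=0) = (1−λ)/4 and P(X=0,Y=0) = P(X=1,Y=1) = (1+λ)/4. Then for every function Φ in the class 𝓕, the Φ-SDPI constant satisfies η_Φ(X, Y) = λ². -/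
open Finset

noncomputable section

/-- The symmetric second difference `f (m + d) + f (m - d) - 2 f m`. -/
def secondDiff (f : ℝ → ℝ) (m d : ℝ) : ℝ := f (m + d) + f (m - d) - 2 * f m

theorem secondDiff_abs (f : ℝ → ℝ) (m d : ℝ) : secondDiff f m |d| = secondDiff f m d := by
  rcases abs_choice d with h | h <;> rw [h]
  unfold secondDiff
  rw [sub_neg_eq_add, ← sub_eq_add_neg]
  ring

theorem Convex.add_sub_mem_of_abs_le {D : Set ℝ} (hD : Convex ℝ D) {m d x : ℝ}
    (h₁ : m + d ∈ D) (h₂ : m - d ∈ D) (hx : |x| ≤ d) : m + x ∈ D := by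
  have hx' := abs_le.1 hx
  exact hD.ordConnected.out h₂ h₁ ⟨by linarith, by linarith⟩

theorem ConvexOn.add_sub_le {s : Set ℝ} {h : ℝ → ℝ} (hh : ConvexOn ℝ s h) {m x y : ℝ}
    (h₁ : m + y ∈ s) (h₂ : m - y ∈ s) (hx : 0 ≤ x) (hxy : x ≤ y) :
    h (m + x) + h (m - x) ≤ h (m + y) + h (m - y) := by
  rcases hx.eq_or_lt with rfl | hx
  · have := hh.2 h₁ h₂ (show (0 : ℝ) ≤ 1 / 2 by norm_num) (show (0 : ℝ) ≤ 1 / 2 by norm_num)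
      (by norm_num)
    simp only [smul_eq_mul] at this
    rw [show 1 / 2 * (m + y) + 1 / 2 * (m - y) = m by ring] at this
    simp only [add_zero, sub_zero]
    linarith
  · have hy : 0 < y := hx.trans_le hxy
    have ha : 0 ≤ (y + x) / (2 * y) := by positivity
    have hb : 0 ≤ (y - x) / (2 * y) := div_nonneg (by linarith) (by linarith)
    have hab : (y + x) / (2 * y) + (y - x) / (2 * y) = 1 := by field_simp; ring
    have e₁ := hh.2 h₁ h₂ ha hb hab
    have e₂ := hh.2 h₂ h₁ ha hb hab
    simp only [smul_eq_mul] at e₁ e₂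
    rw [show (y + x) / (2 * y) * (m + y) + (y - x) / (2 * y) * (m - y) = m + x by
      field_simp; ring] at e₁
    rw [show (y + x) / (2 * y) * (m - y) + (y - x) / (2 * y) * (m + y) = m - x by
      field_simp; ring] at e₂
    have hb' : (y - x) / (2 * y) = 1 - (y + x) / (2 * y) := by linarith
    rw [hb'] at e₁ e₂
    linarith

/-- An even function with nonpositive second differences of step `e` decreases from `0`. -/
theorem le_apply_zero_of_secondDiff_nonpos {φ : ℝ → ℝ} {e : ℝ} (heven : φ (-e) = φ e) (n : ℕ)
    (h : ∀ j : ℕ, j < n → secondDiff φ (j * e) e ≤ 0) : φ (n * e) ≤ φ 0 := by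
  have step : ∀ j : ℕ, j < n → φ ((j + 1 : ℕ) * e) ≤ φ (j * e) := by
    intro j
    induction j with
    | zero =>
      intro hj
      have := h 0 hj
      simp only [secondDiff, Nat.cast_zero, zero_mul, zero_add, zero_sub, heven] at this
      simp only [Nat.cast_zero, zero_mul, zero_add, Nat.cast_one, one_mul]
      linarith
    | succ j ih =>
      intro hj
      have h₁ := ih (by omega)
      have h₂ := h (j + 1) hj
      unfold secondDiff at h₂
      rw [show ((j + 1 : ℕ) : ℝ) * e + e = ((j + 1 + 1 : ℕ) : ℝ) * e by push_cast; ring,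
        show ((j + 1 : ℕ) : ℝ) * e - e = (j : ℝ) * e by push_cast; ring] at h₂
      linarith
  have all : ∀ j : ℕ, j ≤ n → φ (j * e) ≤ φ 0 := by
    intro j
    induction j with
    | zero => intro _; simp
    | succ j ih => intro hj; exact (step j hj).trans (ih (by omega))
  exact all n le_rfl

/-- If the second differences of `f` are convex in the midpoint, then
`d ↦ secondDiff f m d / d ^ 2` is nondecreasing. -/
theorem secondDiff_mul_le {D : Set ℝ} {f : ℝ → ℝ} (hD : Convex ℝ D) (hf : ContinuousOn f D)
    (hconv : ∀ e, ConvexOn ℝ {z | z + e ∈ D ∧ z - e ∈ D} (fun z => secondDiff f z e))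
    {m d r : ℝ} (h₁ : m + d ∈ D) (h₂ : m - d ∈ D) (hd : 0 < d) (hr₀ : 0 ≤ r) (hr₁ : r ≤ 1) :
    secondDiff f m (r * d) ≤ r ^ 2 * secondDiff f m d := by
  have mem : ∀ x, |x| ≤ d → m + x ∈ D := fun x hx => hD.add_sub_mem_of_abs_le h₁ h₂ hx
  set c := secondDiff f m d / d ^ 2 with hc
  have hcd : c * d ^ 2 = secondDiff f m d := by rw [hc]; field_simp
  set φ : ℝ → ℝ := fun x => secondDiff f m x - c * x ^ 2 with hφ
  have hφ0 : φ 0 = 0 := by simp only [hφ, secondDiff, add_zero, sub_zero]; ring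
  have hφd : φ d = 0 := by simp only [hφ]; linarith
  have hcont : ContinuousOn φ (Set.Icc 0 d) := by
    have c₁ : ContinuousOn (fun x => f (m + x)) (Set.Icc 0 d) :=
      hf.comp (by fun_prop) fun x hx => mem x (by rw [abs_of_nonneg hx.1]; exact hx.2)
    have c₂ : ContinuousOn (fun x => f (m - x)) (Set.Icc 0 d) :=
      hf.comp (by fun_prop) fun x hx => by
        rw [sub_eq_add_neg]
        exact mem (-x) (by rw [abs_neg, abs_of_nonneg hx.1]; exact hx.2)
    exact ((c₁.add c₂).sub continuousOn_const).sub (by fun_prop)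
  obtain ⟨x₀, hx₀, hmax⟩ := isCompact_Icc.exists_isMaxOn ⟨0, le_rfl, hd.le⟩ hcont
  have hmax : ∀ x ∈ Set.Icc 0 d, φ x ≤ φ x₀ := fun x hx => hmax hx
  have key : φ x₀ ≤ 0 := by
    by_contra! hpos
    have hx0 : 0 < x₀ := hx₀.1.lt_of_ne (by rintro rfl; linarith)
    have hxd : x₀ < d := hx₀.2.lt_of_ne (by rintro rfl; linarith)
    obtain ⟨n, hn⟩ := exists_nat_gt (max 1 (x₀ / (d - x₀)))
    have hn1 : (1 : ℝ) < n := (le_max_left _ _).trans_lt hn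
    have hn0 : (0 : ℝ) < n := by linarith
    have hn2 : x₀ / (d - x₀) < n := (le_max_right _ _).trans_lt hn
    obtain ⟨e, he⟩ : ∃ e, e = x₀ / n := ⟨_, rfl⟩
    have hne : n * e = x₀ := by rw [he]; field_simp
    have he0 : 0 < e := by rw [he]; positivity
    have hed : x₀ + e ≤ d := by
      rw [div_lt_iff₀ (by linarith)] at hn2
      have : e ≤ d - x₀ := by
        rw [he, div_le_iff₀ hn0]; linarith
      linarith
    have hex : e ≤ x₀ := by nlinarith
    have hdiff : ∀ x, secondDiff φ x e
        = secondDiff f (m + x) e + secondDiff f (m - x) e - 2 * c * e ^ 2 := by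
      intro x
      simp only [hφ, secondDiff]
      rw [show m + (x + e) = m + x + e by ring, show m - (x + e) = m - x - e by ring,
        show m + (x - e) = m + x - e by ring, show m - (x - e) = m - x + e by ring]
      ring
    have hx0e : secondDiff φ x₀ e ≤ 0 := by
      have a₁ := hmax (x₀ + e) ⟨by linarith, hed⟩
      have a₂ := hmax (x₀ - e) ⟨by linarith, by linarith⟩
      unfold secondDiff
      linarith
    have hle : φ (n * e) ≤ φ 0 := by
      refine le_apply_zero_of_secondDiff_nonpos ?_ n fun j hj => ?_
      · simp only [hφ, secondDiff, sub_neg_eq_add, ← sub_eq_add_neg]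
        ring
      · have hj' : (j : ℝ) * e ≤ x₀ := by
          rw [← hne]
          exact mul_le_mul_of_nonneg_right (by exact_mod_cast hj.le) he0.le
        have := (hconv e).add_sub_le (m := m) (x := j * e) (y := x₀)
          ⟨by rw [add_assoc]; exact mem _ (abs_le.2 ⟨by linarith, by linarith⟩),
            by rw [add_sub_assoc]; exact mem _ (abs_le.2 ⟨by linarith, by linarith⟩)⟩
          ⟨by rw [show m - x₀ + e = m + (e - x₀) by ring]
              exact mem _ (abs_le.2 ⟨by linarith, by linarith⟩),
            by rw [show m - x₀ - e = m + (-x₀ - e) by ring]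
               exact mem _ (abs_le.2 ⟨by linarith, by linarith⟩)⟩
          (by positivity) hj'
        rw [hdiff] at hx0e ⊢
        linarith
    rw [hne] at hle
    linarith
  have hfin := (hmax (r * d) ⟨by positivity, by nlinarith⟩).trans key
  simp only [hφ] at hfin
  rw [← hcd]
  linarith

/-- A continuous convex function whose second differences contract by less than `r ^ 2` when the
step is scaled by `r` is affine on triples of points. -/
theorem ConvexOn.eq_of_secondDiff_mul_le {D : Set ℝ} {f : ℝ → ℝ} (hconv : ConvexOn ℝ D f)
    (hf : ContinuousOn f D) {l r : ℝ} (hl : 0 ≤ l) (hlr : l < r ^ 2) (hr₀ : 0 < r) (hr₁ : r ≤ 1)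
    (h : ∀ m d, m + d ∈ D → m - d ∈ D → secondDiff f m (r * d) ≤ l * secondDiff f m d)
    {x y z : ℝ} (hx : x ∈ D) (hz : z ∈ D) (hxy : x < y) (hyz : y < z) :
    (z - x) * f y = (z - y) * f x + (y - x) * f z := by
  have hsub : Set.Icc x z ⊆ D := hconv.1.ordConnected.out hx hz
  have hxz : 0 < z - x := by linarith
  have hle : (z - x) * f y ≤ (z - y) * f x + (y - x) * f z := by
    have := hconv.slope_mono_adjacent hx hz hxy hyz
    rw [div_le_div_iff₀ (by linarith) (by linarith)] at this
    linarith
  by_contra hne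
  have hlt := hle.lt_of_ne hne
  obtain ⟨s, hs⟩ : ∃ s, s * (z - x) = f z - f x := ⟨(f z - f x) / (z - x), by field_simp⟩
  have hgap : 0 < f x + s * (y - x) - f y := by
    by_contra! hcon
    nlinarith
  have hprod : 0 < (y - x) * (z - y) := mul_pos (by linarith) (by linarith)
  obtain ⟨ε, hε⟩ : ∃ ε, ε = (f x + s * (y - x) - f y) / (2 * ((y - x) * (z - y))) := ⟨_, rfl⟩
  have hε0 : 0 < ε := by rw [hε]; positivity
  have hεy : ε * ((y - x) * (z - y)) = (f x + s * (y - x) - f y) / 2 := by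
    rw [hε, div_mul_eq_mul_div, div_eq_div_iff (by positivity) (by norm_num)]
    ring
  set χ : ℝ → ℝ := fun t => f t - (f x + s * (t - x)) + ε * ((t - x) * (z - t)) with hχ
  have hcont : ContinuousOn χ (Set.Icc x z) :=
    ((hf.mono hsub).sub (by fun_prop)).add (by fun_prop)
  obtain ⟨t, ht, hmin⟩ := isCompact_Icc.exists_isMinOn ⟨y, hxy.le, hyz.le⟩ hcont
  have hmin : ∀ u ∈ Set.Icc x z, χ t ≤ χ u := fun u hu => hmin hu
  have hneg : χ t < 0 := by
    refine (hmin y ⟨hxy.le, hyz.le⟩).trans_lt ?_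
    simp only [hχ]
    linarith
  have hxt : x < t := ht.1.lt_of_ne (by
    rintro rfl
    simp only [hχ, sub_self] at hneg
    linarith)
  have htz : t < z := ht.2.lt_of_ne (by
    rintro rfl
    simp only [hχ, sub_self] at hneg
    linarith)
  obtain ⟨e, he0, he₁, he₂⟩ : ∃ e, 0 < e ∧ e ≤ t - x ∧ e ≤ z - t :=
    ⟨min (t - x) (z - t), lt_min (by linarith) (by linarith), min_le_left _ _, min_le_right _ _⟩
  have hrk : ∀ k : ℕ, 0 < r ^ k * e ∧ r ^ k * e ≤ e := fun k =>
    ⟨by positivity, mul_le_of_le_one_left he0.le (pow_le_one₀ hr₀.le hr₁)⟩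
  have hupper : ∀ k : ℕ, secondDiff f t (r ^ k * e) ≤ l ^ k * secondDiff f t e := by
    intro k
    induction k with
    | zero => simp
    | succ k ih =>
      obtain ⟨p₀, p₁⟩ := hrk k
      have := h t (r ^ k * e) (hsub ⟨by linarith, by linarith⟩) (hsub ⟨by linarith, by linarith⟩)
      rw [pow_succ', pow_succ', mul_assoc, mul_assoc]
      exact this.trans (mul_le_mul_of_nonneg_left ih hl)
  have hlower : ∀ k : ℕ, 2 * ε * (r ^ k * e) ^ 2 ≤ secondDiff f t (r ^ k * e) := by
    intro k
    obtain ⟨p₀, p₁⟩ := hrk k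
    have a₁ := hmin (t + r ^ k * e) ⟨by linarith, by linarith⟩
    have a₂ := hmin (t - r ^ k * e) ⟨by linarith, by linarith⟩
    simp only [hχ] at a₁ a₂
    unfold secondDiff
    linarith
  have hbound : ∀ k : ℕ, 2 * ε * e ^ 2 ≤ (l / r ^ 2) ^ k * secondDiff f t e := by
    intro k
    have := (hlower k).trans (hupper k)
    rw [div_pow, div_mul_eq_mul_div, le_div_iff₀ (by positivity)]
    calc 2 * ε * e ^ 2 * (r ^ 2) ^ k = 2 * ε * (r ^ k * e) ^ 2 := by ring
      _ ≤ _ := this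
  have hlim := (tendsto_pow_atTop_nhds_zero_of_lt_one (div_nonneg hl (by positivity))
    ((div_lt_one (by positivity)).2 hlr)).mul_const (secondDiff f t e)
  rw [zero_mul] at hlim
  have := ge_of_tendsto' hlim hbound
  have : 0 < 2 * ε * e ^ 2 := by positivity
  linarith

theorem exists_affine_of_three_points {D : Set ℝ} {f : ℝ → ℝ}
    (h : ∀ x ∈ D, ∀ y ∈ D, ∀ z ∈ D, x < y → y < z →
      (z - x) * f y = (z - y) * f x + (y - x) * f z) :
    ∃ a b : ℝ, ∀ t ∈ D, f t = a * t + b := by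
  by_cases hD : ∃ u ∈ D, ∃ v ∈ D, u < v
  · obtain ⟨u, hu, v, hv, huv⟩ := hD
    have huv' : v - u ≠ 0 := by linarith
    refine ⟨(f v - f u) / (v - u), f u - (f v - f u) / (v - u) * u, fun t ht => ?_⟩
    suffices (v - u) * f t = (v - t) * f u + (t - u) * f v by
      field_simp
      linarith
    rcases lt_trichotomy t u with htu | rfl | htu
    · linarith [h t ht u hu v hv htu huv]
    · ring
    rcases lt_trichotomy t v with htv | rfl | htv
    · exact h u hu t ht v hv htu htv
    · ring
    · linarith [h u hu v hv t ht huv htv]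
  · push Not at hD
    by_cases hne : D.Nonempty
    · obtain ⟨u, hu⟩ := hne
      refine ⟨0, f u, fun t ht => ?_⟩
      rw [le_antisymm (hD u hu t ht) (hD t ht u hu)]
      ring
    · exact ⟨0, 0, fun t ht => (hne ⟨t, ht⟩).elim⟩

theorem ClassF.convexOn_secondDiff (F : ClassF) (e : ℝ) :
    ConvexOn ℝ {z | z + e ∈ F.D ∧ z - e ∈ F.D} (fun z => secondDiff F.Φ z e) := by
  have hj := F.joint_convex (1 / 2) ⟨by norm_num, by norm_num⟩
  have comb : ∀ {a b x y c : ℝ}, a + b = 1 → a * (x + c) + b * (y + c) = a * x + b * y + c := by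
    intro a b x y c hab
    linear_combination c * hab
  refine ⟨?_, ?_⟩
  · rintro x ⟨hx₁, hx₂⟩ y ⟨hy₁, hy₂⟩ a b ha hb hab
    have m₁ := F.convex_dom hx₁ hy₁ ha hb hab
    have m₂ := F.convex_dom hx₂ hy₂ ha hb hab
    simp only [smul_eq_mul, sub_eq_add_neg, comb hab] at m₁ m₂
    exact ⟨by simpa using m₁, by simpa [sub_eq_add_neg] using m₂⟩
  · rintro x ⟨hx₁, hx₂⟩ y ⟨hy₁, hy₂⟩ a b ha hb hab
    have := hj.2 (x := (x + e, x - e)) ⟨hx₁, hx₂⟩ (y := (y + e, y - e)) ⟨hy₁, hy₂⟩ ha hb hab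
    simp only [smul_eq_mul, Prod.smul_mk, Prod.mk_add_mk, sub_eq_add_neg, comb hab] at this
    simp only [smul_eq_mul, secondDiff, sub_eq_add_neg]
    have avg : ∀ w : ℝ, 1 / 2 * (w + e) + (1 + -(1 / 2)) * (w + -e) = w := fun w => by ring
    rw [avg, avg, avg] at this
    linarith

theorem Hphi_fst_DSBS (Φ : ℝ → ℝ) (lam : ℝ) (f : Bool → ℝ) :
    Hphi Φ (fun xy : Bool × Bool => if xy.1 = xy.2 then (1 + lam) / 4 else (1 - lam) / 4)
        (fun ω => f ω.1)
      = secondDiff Φ ((f true + f false) / 2) ((f true - f false) / 2) / 2 := by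
  simp only [Hphi, _root_.expect, secondDiff, Fintype.sum_prod_type, Fintype.sum_bool, reduceCtorEq,
    if_true, if_false]
  ring_nf

theorem condExp_snd_DSBS (lam : ℝ) (f : Bool → ℝ) (ω : Bool × Bool) :
    condExp (fun xy : Bool × Bool => if xy.1 = xy.2 then (1 + lam) / 4 else (1 - lam) / 4)
        (fun ω => f ω.1) Prod.snd ω
      = (1 + lam) / 2 * f ω.2 + (1 - lam) / 2 * f (!ω.2) := by
  rcases ω with ⟨x, _ | _⟩ <;>
  · simp only [condExp, Fintype.sum_prod_type, Fintype.sum_bool, Bool.not_true, Bool.not_false,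
      reduceCtorEq, if_true, if_false]
    ring_nf

theorem Hphi_condExp_DSBS (Φ : ℝ → ℝ) (lam : ℝ) (f : Bool → ℝ) :
    Hphi Φ (fun xy : Bool × Bool => if xy.1 = xy.2 then (1 + lam) / 4 else (1 - lam) / 4)
        (condExp (fun xy : Bool × Bool => if xy.1 = xy.2 then (1 + lam) / 4 else (1 - lam) / 4)
          (fun ω => f ω.1) Prod.snd)
      = secondDiff Φ ((f true + f false) / 2) (lam * ((f true - f false) / 2)) / 2 := by
  simp only [Hphi, _root_.expect, condExp_snd_DSBS, secondDiff, Fintype.sum_prod_type,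
    Fintype.sum_bool, Bool.not_true, Bool.not_false, reduceCtorEq, if_true, if_false]
  ring_nf

/-- For the doubly symmetric binary source `DSBS(λ)` with parameter
`λ ∈ [0,1]` (uniform binary marginals, `P(X≠Y) = (1−λ)/2`), and every `Φ ∈ 𝓕`,
the Φ-SDPI constant equals `λ²`. -/
theorem etaPhi_DSBS
    (lam : ℝ) (hlam : lam ∈ Set.Icc (0:ℝ) 1) (F : ClassF) :
    etaPhi F.Φ F.D
        (fun xy : Bool × Bool => if xy.1 = xy.2 then (1 + lam) / 4 else (1 - lam) / 4)
      = lam ^ 2 := by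
  have hcont : ContinuousOn F.Φ F.D := F.smooth.continuousOn
  refine IsLeast.csInf_eq ⟨⟨sq_nonneg lam, fun f hf => ?_⟩, ?_⟩
  · rw [Hphi_fst_DSBS, Hphi_condExp_DSBS]
    set m := (f true + f false) / 2 with hm
    set d := (f true - f false) / 2 with hd
    suffices secondDiff F.Φ m (lam * d) ≤ lam ^ 2 * secondDiff F.Φ m d by linarith
    have h₁ : m + d ∈ F.D := by
      rw [show m + d = f true by rw [hm, hd]; ring]
      exact hf true
    have h₂ : m - d ∈ F.D := by
      rw [show m - d = f false by rw [hm, hd]; ring]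
      exact hf false
    rw [← secondDiff_abs _ _ (lam * d), ← secondDiff_abs _ _ d, abs_mul, abs_of_nonneg hlam.1]
    rcases (abs_nonneg d).eq_or_lt with h0 | hpos
    · simp only [← h0, secondDiff, mul_zero, add_zero, sub_zero]
      linarith [mul_zero (lam ^ 2)]
    · have habs : m + |d| ∈ F.D ∧ m - |d| ∈ F.D := by
        rcases abs_choice d with h | h <;> rw [h]
        · exact ⟨h₁, h₂⟩
        · exact ⟨by rwa [← sub_eq_add_neg], by rwa [sub_neg_eq_add]⟩
      exact secondDiff_mul_le F.convex_dom hcont F.convexOn_secondDiff habs.1 habs.2 hpos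
        hlam.1 hlam.2
  · rintro l ⟨hl, hf⟩
    by_contra! hlt
    have hpos : 0 < lam := hlam.1.lt_of_ne (by
      rintro rfl
      norm_num at hlt
      linarith)
    refine F.not_affine (exists_affine_of_three_points fun x hx y _ z hz hxy hyz =>
      F.convexOn.eq_of_secondDiff_mul_le hcont hl hlt hpos hlam.2 (fun m d h₁ h₂ => ?_)
        hx hz hxy hyz)
    set g : Bool → ℝ := fun b => if b then m + d else m - d with hg
    have := hf g (by rintro (_ | _) <;> simpa [hg])
    rw [Hphi_fst_DSBS, Hphi_condExp_DSBS] at this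
    simp only [hg, if_true, Bool.false_eq_true, if_false] at this
    rw [show (m + d + (m - d)) / 2 = m by ring, show (m + d - (m - d)) / 2 = d by ring] at this
    linarith

end
end
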